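/- The binary code C of a (6,4) net has dimension at least 21 over F₂: the only F₂-linear dependencies among the 24 characteristic functions of the lines are those generated by the three parallel class dependencies Σ_{λ∈Πᵢ} v^λ + Σ_{λ∈Π₄} v^λ = 0 (i = 1, 2, 3), so dim C ≥ 24 − 3 = 21. -/

import Mathlib

/-- A `(6,4)` net on a point type `P`: 36 points, lines of size 6 indexed by
4 parallel classes of 6 lines each; each parallel class partitions the point set,
and two lines from different parallel classes meet in exactly one point. -/
structure Net64 (P : Type) [Fintype P] [DecidableEq P] where
  line : Fin 4 → Fin 6 → Finset P
  card_points : Fintype.card P = 36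
  line_card : ∀ i j, (line i j).card = 6
  partition : ∀ (i : Fin 4) (p : P), ∃! j : Fin 6, p ∈ line i j
  meet : ∀ (i i' : Fin 4) (j j' : Fin 6), i ≠ i' → (line i j ∩ line i' j').card = 1

/-- The characteristic function `v^s` of a finite set `s`, with values in `F₂`. -/
def chi {P : Type} [DecidableEq P] (s : Finset P) : P → ZMod 2 :=
  fun p => if p ∈ s then 1 else 0

/-- The binary code of a net: the `F₂`-span of the characteristic functions of its lines. -/
def Net64.code {P : Type} [Fintype P] [DecidableEq P] (N : Net64 P) :
    Submodule (ZMod 2) (P → ZMod 2) :=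
  Submodule.span (ZMod 2) (Set.range fun x : Fin 4 × Fin 6 => chi (N.line x.1 x.2))

/-- `c(Λ)`: the `F₂`-sum of the characteristic functions of a set of lines of the net,
a set of lines being given by the finite set of its (class, index) pairs. -/
def Net64.cSum {P : Type} [Fintype P] [DecidableEq P] (N : Net64 P)
    (Λ : Finset (Fin 4 × Fin 6)) : P → ZMod 2 :=
  ∑ x ∈ Λ, chi (N.line x.1 x.2)

/-- `lᵢ = |Λ ∩ Πᵢ|`: the number of lines of `Λ` in the `i`-th parallel class. -/
def lcount (Λ : Finset (Fin 4 × Fin 6)) (i : Fin 4) : ℕ :=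
  (Λ.filter fun x => x.1 = i).card

/-- `pⱼ`: the number of points of the net lying on exactly `j` lines of `Λ`. -/
def Net64.pcount {P : Type} [Fintype P] [DecidableEq P] (N : Net64 P)
    (Λ : Finset (Fin 4 × Fin 6)) (j : ℕ) : ℕ :=
  (Finset.univ.filter fun p : P => (Λ.filter fun x => p ∈ N.line x.1 x.2).card = j).card

/-- Admissible labels for a point on row `r`, column `c`, third line `l`, fourth line `m`. -/
def net64Unary (r c l m : ℕ) : Bool :=
  cond (Nat.blt r 2)
    (cond (Nat.blt c 2) (Nat.beq l (2 + 2 * r + c) && Nat.beq m (2 + 2 * r + c))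
      (cond (Nat.blt l 2) (Nat.beq c (2 + 2 * r + l) && !Nat.blt m 2) (Nat.blt m 2)))
    (cond (Nat.blt c 2)
      (cond (Nat.blt l 2) (Nat.beq r (2 + 2 * c + l) && !Nat.blt m 2) (Nat.blt m 2))
      (cond (Nat.blt l 2) (Nat.blt m 2) (!Nat.blt m 2)))

/-- The set of pairs of lines meeting in a given point, as a bit mask. -/
def net64Mask (r c l m : ℕ) : ℕ :=
  Nat.lor (2 ^ (6 * r + l)) (Nat.lor (2 ^ (36 + (6 * r + m)))
    (Nat.lor (2 ^ (72 + (6 * c + l))) (Nat.lor (2 ^ (108 + (6 * c + m))) (2 ^ (144 + (6 * l + m))))))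

/-- Backtracking search for the labels of the remaining cells. -/
def net64Search : List (ℕ × ℕ) → ℕ → Bool
  | [], _ => true
  | x :: rest, st =>
    [0, 1, 2, 3, 4, 5].any fun l => [0, 1, 2, 3, 4, 5].any fun m =>
      net64Unary x.1 x.2 l m && (Nat.beq (Nat.land st (net64Mask x.1 x.2 l m)) 0 &&
        net64Search rest (Nat.lor st (net64Mask x.1 x.2 l m)))

def net64Cells : List (ℕ × ℕ) :=
  [(0,0),(0,1),(0,2),(0,3),(0,4),(0,5),(1,0),(2,0),(3,0),(4,0),(5,0),
   (1,1),(1,2),(1,3),(1,4),(1,5),(2,1),(3,1),(4,1),(5,1),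
   (2,2),(2,3),(2,4),(2,5),(3,2),(4,2),(5,2),
   (3,3),(3,4),(3,5),(4,3),(5,3),(4,4),(4,5),(5,4),(5,5)]

theorem net64Search_false : net64Search net64Cells 0 = false := by decide +kernel

theorem net64Search_sound (A B : ℕ × ℕ → ℕ) : ∀ (cells : List (ℕ × ℕ)) (st : ℕ),
    cells.Pairwise (fun x y =>
      net64Mask x.1 x.2 (A x) (B x) &&& net64Mask y.1 y.2 (A y) (B y) = 0) →
    (∀ x ∈ cells, net64Unary x.1 x.2 (A x) (B x) = true ∧ A x < 6 ∧ B x < 6 ∧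
      st &&& net64Mask x.1 x.2 (A x) (B x) = 0) →
    net64Search cells st = true
  | [], _, _, _ => rfl
  | x :: rest, st, hp, h => by
    rw [List.pairwise_cons] at hp
    obtain ⟨h1, h2, h3, h4⟩ := h x (by simp)
    rw [net64Search, List.any_eq_true]
    refine ⟨A x, by simp; omega, ?_⟩
    rw [List.any_eq_true]
    refine ⟨B x, by simp; omega, ?_⟩
    rw [h1, Bool.true_and, Bool.and_eq_true]
    refine ⟨by rw [Nat.beq_eq]; exact h4, ?_⟩
    apply net64Search_sound A B rest _ hp.2
    intro y hy
    obtain ⟨k1, k2, k3, k4⟩ := h y (by simp [hy])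
    refine ⟨k1, k2, k3, ?_⟩
    have := hp.1 y hy
    show (st ||| net64Mask x.1 x.2 (A x) (B x)) &&& _ = 0
    rw [Nat.and_or_distrib_right, k4, this]
    rfl

theorem net64Mask_testBit (r c l m k : ℕ) (h : (net64Mask r c l m).testBit k = true) :
    k = 6 * r + l ∨ k = 36 + (6 * r + m) ∨ k = 72 + (6 * c + l) ∨ k = 108 + (6 * c + m) ∨
      k = 144 + (6 * l + m) := by
  have e : net64Mask r c l m = (2 ^ (6 * r + l)) ||| ((2 ^ (36 + (6 * r + m))) |||
    ((2 ^ (72 + (6 * c + l))) ||| ((2 ^ (108 + (6 * c + m))) ||| (2 ^ (144 + (6 * l + m)))))) := rfl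
  rw [e] at h
  simp only [Nat.testBit_or, Nat.testBit_two_pow, Bool.or_eq_true, decide_eq_true_eq] at h
  omega

theorem net64Mask_disj (r c l m r' c' l' m' : ℕ)
    (h : r < 6 ∧ c < 6 ∧ l < 6 ∧ m < 6) (h' : r' < 6 ∧ c' < 6 ∧ l' < 6 ∧ m' < 6)
    (h1 : ¬ (r = r' ∧ l = l')) (h2 : ¬ (r = r' ∧ m = m')) (h3 : ¬ (c = c' ∧ l = l'))
    (h4 : ¬ (c = c' ∧ m = m')) (h5 : ¬ (l = l' ∧ m = m')) :
    net64Mask r c l m &&& net64Mask r' c' l' m' = 0 := by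
  apply Nat.eq_of_testBit_eq
  intro k
  rw [Nat.zero_testBit, Nat.testBit_and]
  by_contra hk
  rw [Bool.not_eq_false, Bool.and_eq_true] at hk
  have a := net64Mask_testBit _ _ _ _ _ hk.1
  have b := net64Mask_testBit _ _ _ _ _ hk.2
  clear hk
  rcases a with a | a | a | a | a <;> rcases b with b | b | b | b | b <;> omega

theorem net64_core1 {P : Type} (d : Fin 4 → P → Fin 6)
    (hpt : ∀ i i' : Fin 4, i ≠ i' → ∀ j j', ∃! p, d i p = j ∧ d i' p = j')
    (hun : ∀ p, net64Unary (d 0 p) (d 1 p) (d 2 p) (d 3 p) = true) : False := by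
  have hq : ∀ x : ℕ × ℕ, ∃ p, x.1 < 6 → x.2 < 6 → (d 0 p).val = x.1 ∧ (d 1 p).val = x.2 := by
    intro x
    obtain ⟨p0, -⟩ := (hpt 0 1 (by decide) 0 0).exists
    by_cases h : x.1 < 6 ∧ x.2 < 6
    · obtain ⟨p, h1, h2⟩ := (hpt 0 1 (by decide) ⟨x.1, h.1⟩ ⟨x.2, h.2⟩).exists
      exact ⟨p, fun _ _ => by simp [h1, h2]⟩
    · exact ⟨p0, fun a b => (h ⟨a, b⟩).elim⟩
  choose q hq using hq
  have hin : ∀ x ∈ net64Cells, x.1 < 6 ∧ x.2 < 6 := by decide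
  have hne : net64Cells.Pairwise (fun x y => x ≠ y) := by decide
  have key : net64Search net64Cells 0 = true := by
    apply net64Search_sound (fun x => (d 2 (q x)).val) (fun x => (d 3 (q x)).val)
    · refine List.Pairwise.imp_of_mem ?_ hne
      intro x y hx hy hxy
      obtain ⟨x1, x2⟩ := hin x hx
      obtain ⟨y1, y2⟩ := hin y hy
      obtain ⟨ex1, ex2⟩ := hq x x1 x2
      obtain ⟨ey1, ey2⟩ := hq y y1 y2
      have hqq : q x ≠ q y := by
        intro e
        apply hxy
        rw [e] at ex1 ex2
        exact Prod.ext (ex1.symm.trans ey1) (ex2.symm.trans ey2)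
      have hh : ∀ i i' : Fin 4, i ≠ i' →
          ¬ ((d i (q x)).val = (d i (q y)).val ∧ (d i' (q x)).val = (d i' (q y)).val) := by
        rintro i i' hi ⟨a, b⟩
        exact hqq ((hpt i i' hi (d i (q y)) (d i' (q y))).unique
          ⟨Fin.ext a, Fin.ext b⟩ ⟨rfl, rfl⟩)
      apply net64Mask_disj
      · exact ⟨x1, x2, (d 2 (q x)).isLt, (d 3 (q x)).isLt⟩
      · exact ⟨y1, y2, (d 2 (q y)).isLt, (d 3 (q y)).isLt⟩
      · rw [← ex1, ← ey1]; exact hh 0 2 (by decide)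
      · rw [← ex1, ← ey1]; exact hh 0 3 (by decide)
      · rw [← ex2, ← ey2]; exact hh 1 2 (by decide)
      · rw [← ex2, ← ey2]; exact hh 1 3 (by decide)
      · exact hh 2 3 (by decide)
    · intro x hx
      obtain ⟨x1, x2⟩ := hin x hx
      obtain ⟨ex1, ex2⟩ := hq x x1 x2
      refine ⟨?_, (d 2 (q x)).isLt, (d 3 (q x)).isLt, Nat.zero_and _⟩
      rw [← ex1, ← ex2]
      exact hun (q x)
  rw [net64Search_false] at key
  exact Bool.false_ne_true key

theorem net64_inj {P : Type} (c : Fin 4 → P → Fin 6)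
    (hpt : ∀ i i' : Fin 4, i ≠ i' → ∀ j j', ∃! p, c i p = j ∧ c i' p = j')
    (g : Fin 4 → Fin 6 → Bool)
    (htwo : ∀ i u v w, g i u = true → g i v = true → g i w = true → u ≠ v → w = u ∨ w = v)
    (hex : ∀ i, ∃ u, g i u = true)
    (i j k l : Fin 4) (hik : i ≠ k) (hjk : j ≠ k) (hkl : k ≠ l)
    (hsum : ∀ p, (g i (c i p)).toNat + (g j (c j p)).toNat + (g k (c k p)).toNat
      + (g l (c l p)).toNat = 0 ∨ (g i (c i p)).toNat + (g j (c j p)).toNat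
      + (g k (c k p)).toNat + (g l (c l p)).toNat = 2)
    (p q : P) (pi : g i (c i p) = true) (pj : g j (c j p) = true)
    (qi : g i (c i q) = true) (qj : g j (c j q) = true) (e : c k p = c k q) : p = q := by
  by_contra hne
  have hi : c i p ≠ c i q := fun h =>
    hne ((hpt i k hik (c i q) (c k q)).unique ⟨h, e⟩ ⟨rfl, rfl⟩)
  have hj : c j p ≠ c j q := fun h =>
    hne ((hpt j k hjk (c j q) (c k q)).unique ⟨h, e⟩ ⟨rfl, rfl⟩)
  obtain ⟨u, hu⟩ := hex l
  obtain ⟨w, ⟨wk, wl⟩, -⟩ := hpt k l hkl (c k p) u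
  have sp := hsum p
  have sq := hsum q
  have sw := hsum w
  have wl' : g l (c l w) = true := by rw [wl]; exact hu
  have hwp : w ≠ p := by
    rintro rfl
    simp [pi, pj, wl'] at sp
    omega
  have hwq : w ≠ q := by
    rintro rfl
    simp [qi, qj, wl'] at sq
    omega
  have pk : g k (c k p) = false := by
    by_contra h
    rw [Bool.not_eq_false] at h
    simp [pi, pj, h] at sp
    omega
  have wk' : g k (c k w) = false := by rw [wk]; exact pk
  have hor : g i (c i w) = true ∨ g j (c j w) = true := by
    by_contra h
    push Not at h
    simp [h.1, h.2, wl', wk'] at sw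
  rcases hor with h | h
  · rcases htwo i _ _ _ pi qi h hi with h' | h'
    · exact hwp ((hpt i k hik (c i p) (c k p)).unique ⟨h', wk⟩ ⟨rfl, rfl⟩)
    · exact hwq ((hpt i k hik (c i q) (c k q)).unique ⟨h', wk.trans e⟩ ⟨rfl, rfl⟩)
  · rcases htwo j _ _ _ pj qj h hj with h' | h'
    · exact hwp ((hpt j k hjk (c j p) (c k p)).unique ⟨h', wk⟩ ⟨rfl, rfl⟩)
    · exact hwq ((hpt j k hjk (c j q) (c k q)).unique ⟨h', wk.trans e⟩ ⟨rfl, rfl⟩)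

/-- Labelling of the lines of class `k`: the special ones get `0, 1`, the line through the
intersection of the special lines `a` of class `i` and `b` of class `j` gets `2 + 2 a + b`. -/
theorem net64_label {P : Type} (c : Fin 4 → P → Fin 6)
    (hpt : ∀ i i' : Fin 4, i ≠ i' → ∀ j j', ∃! p, c i p = j ∧ c i' p = j')
    (g : Fin 4 → Fin 6 → Bool) (s : Fin 4 → Fin 2 → Fin 6)
    (hs : ∀ i, s i 0 ≠ s i 1) (hg : ∀ i u, g i u = true ↔ u = s i 0 ∨ u = s i 1)
    (i j k l : Fin 4) (hij : i ≠ j) (hik : i ≠ k) (hjk : j ≠ k) (hkl : k ≠ l)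
    (hsum : ∀ p, (g i (c i p)).toNat + (g j (c j p)).toNat + (g k (c k p)).toNat
      + (g l (c l p)).toNat = 0 ∨ (g i (c i p)).toNat + (g j (c j p)).toNat
      + (g k (c k p)).toNat + (g l (c l p)).toNat = 2) :
    ∃ E : Fin 6 ≃ Fin 6, E 0 = s k 0 ∧ E 1 = s k 1 ∧
      ∀ (p : P) (a b : Fin 2), c i p = s i a → c j p = s j b →
        (E.symm (c k p)).val = 2 + 2 * a.val + b.val := by
  have hgs : ∀ i a, g i (s i a) = true := by
    intro i a
    rw [hg]
    fin_cases a <;> simp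
  have hsi : ∀ i a b, s i a = s i b → a = b := by
    intro i a b h
    have := hs i
    have := (hs i).symm
    fin_cases a <;> fin_cases b <;> simp_all
  have hX : ∀ a b, ∃ p, c i p = s i a ∧ c j p = s j b := fun a b => (hpt i j hij _ _).exists
  choose X hX1 hX2 using hX
  have hinj := net64_inj c hpt g (by
    intro i u v w h1 h2 h3 h
    rw [hg] at h1 h2 h3
    rcases h1 with rfl | rfl <;> rcases h2 with rfl | rfl <;> rcases h3 with rfl | rfl <;>
      simp_all) (fun i => ⟨s i 0, hgs i 0⟩) i j k l hik hjk hkl hsum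
  have hXi : ∀ a b a' b', c k (X a b) = c k (X a' b') → a = a' ∧ b = b' := by
    intro a b a' b' h
    have e := hinj (X a b) (X a' b') (by rw [hX1]; apply hgs) (by rw [hX2]; apply hgs)
      (by rw [hX1]; apply hgs) (by rw [hX2]; apply hgs) h
    constructor
    · apply hsi i; rw [← hX1 a b, e, hX1]
    · apply hsi j; rw [← hX2 a b, e, hX2]
  have hXs : ∀ a b t, c k (X a b) ≠ s k t := by
    intro a b t h
    have h1 := hsum (X a b)
    rw [h, hX1, hX2, hgs, hgs, hgs] at h1
    simp at h1
    omega
  have hkk := hs k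
  let f : Fin 6 → Fin 6 :=
    ![s k 0, s k 1, c k (X 0 0), c k (X 0 1), c k (X 1 0), c k (X 1 1)]
  have hf : Function.Injective f := by
    have q1 := hXi 0 0 0 1
    have q2 := hXi 0 0 1 0
    have q3 := hXi 0 0 1 1
    have q4 := hXi 0 1 1 0
    have q5 := hXi 0 1 1 1
    have q6 := hXi 1 0 1 1
    have r1 := fun a b => hXs a b 0
    have r2 := fun a b => hXs a b 1
    have r1' := fun a b => (hXs a b 0).symm
    have r2' := fun a b => (hXs a b 1).symm
    simp only [Fin.isValue, zero_ne_one, one_ne_zero, and_false, and_true, and_self,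
      imp_false] at q1 q2 q3 q4 q5 q6
    intro x y h
    fin_cases x <;> fin_cases y <;> first | rfl | (exfalso; simp [f] at h; first
      | exact hkk h | exact hkk h.symm | exact r1 _ _ h | exact r2 _ _ h | exact r1' _ _ h
      | exact r2' _ _ h | exact q1 h | exact q2 h | exact q3 h | exact q4 h | exact q5 h
      | exact q6 h | exact q1 h.symm | exact q2 h.symm | exact q3 h.symm | exact q4 h.symm
      | exact q5 h.symm | exact q6 h.symm)
  have hb : Function.Bijective f := Finite.injective_iff_bijective.mp hf
  refine ⟨Equiv.ofBijective f hb, rfl, rfl, ?_⟩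
  intro p a b h1 h2
  have e : p = X a b := (hpt i j hij (s i a) (s j b)).unique ⟨h1, h2⟩ ⟨hX1 a b, hX2 a b⟩
  subst e
  have : c k (X a b) = Equiv.ofBijective f hb ⟨2 + 2 * a.val + b.val, by omega⟩ := by
    rw [Equiv.ofBijective_apply]
    fin_cases a <;> fin_cases b <;> rfl
  rw [this, Equiv.symm_apply_apply]

theorem net64_core2 {P : Type} (c : Fin 4 → P → Fin 6)
    (hpt : ∀ i i' : Fin 4, i ≠ i' → ∀ j j', ∃! p, c i p = j ∧ c i' p = j')
    (g : Fin 4 → Fin 6 → Bool) (s : Fin 4 → Fin 2 → Fin 6)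
    (hs : ∀ i, s i 0 ≠ s i 1) (hg : ∀ i u, g i u = true ↔ u = s i 0 ∨ u = s i 1)
    (hsum : ∀ p, (g 0 (c 0 p)).toNat + (g 1 (c 1 p)).toNat + (g 2 (c 2 p)).toNat
      + (g 3 (c 3 p)).toNat = 0 ∨ (g 0 (c 0 p)).toNat + (g 1 (c 1 p)).toNat
      + (g 2 (c 2 p)).toNat + (g 3 (c 3 p)).toNat = 2) : False := by
  obtain ⟨E0, a0, b0, n0⟩ := net64_label c hpt g s hs hg 1 2 0 3 (by decide) (by decide)
    (by decide) (by decide) (fun p => by have := hsum p; omega)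
  obtain ⟨E1, a1, b1, n1⟩ := net64_label c hpt g s hs hg 0 2 1 3 (by decide) (by decide)
    (by decide) (by decide) (fun p => by have := hsum p; omega)
  obtain ⟨E2, a2, b2, n2⟩ := net64_label c hpt g s hs hg 0 1 2 3 (by decide) (by decide)
    (by decide) (by decide) (fun p => by have := hsum p; omega)
  obtain ⟨E3, a3, b3, n3⟩ := net64_label c hpt g s hs hg 0 1 3 2 (by decide) (by decide)
    (by decide) (by decide) (fun p => by have := hsum p; omega)
  let E : Fin 4 → (Fin 6 ≃ Fin 6) := ![E0, E1, E2, E3]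
  have hE : ∀ i, E i 0 = s i 0 ∧ E i 1 = s i 1 := by
    intro i
    fin_cases i
    exacts [⟨a0, b0⟩, ⟨a1, b1⟩, ⟨a2, b2⟩, ⟨a3, b3⟩]
  have hlt : ∀ i u, (g i u).toNat = if ((E i).symm u).val < 2 then 1 else 0 := by
    intro i u
    obtain ⟨v, rfl⟩ := (E i).surjective u
    rw [Equiv.symm_apply_apply]
    have h1 := hg i (E i v)
    rw [← (hE i).1, ← (hE i).2, (E i).apply_eq_iff_eq, (E i).apply_eq_iff_eq] at h1
    have h2 : (v = 0 ∨ v = 1) ↔ v.val < 2 :=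
      (by decide : ∀ v : Fin 6, (v = 0 ∨ v = 1) ↔ v.val < 2) v
    rw [h2] at h1
    by_cases h : v.val < 2
    · rw [if_pos h, h1.mpr h]; rfl
    · rw [if_neg h, Bool.eq_false_iff.mpr (fun h' => h (h1.mp h'))]; rfl
  have hsp : ∀ i p (h : ((E i).symm (c i p)).val < 2),
      c i p = s i ⟨((E i).symm (c i p)).val, h⟩ := by
    intro i p
    obtain ⟨v, hv⟩ := (E i).surjective (c i p)
    rw [← hv, Equiv.symm_apply_apply]
    intro h
    obtain ⟨v, hv'⟩ := v
    have e : v = 0 ∨ v = 1 := by simp only at h; omega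
    rcases e with rfl | rfl
    · exact (hE i).1
    · exact (hE i).2
  have key : ∀ r c l m : Fin 6,
      (((if r.val < 2 then 1 else 0) + (if c.val < 2 then 1 else 0) + (if l.val < 2 then 1 else 0)
        + (if m.val < 2 then 1 else 0) = 0) ∨
      ((if r.val < 2 then 1 else 0) + (if c.val < 2 then 1 else 0) + (if l.val < 2 then 1 else 0)
        + (if m.val < 2 then 1 else 0) = 2)) →
      (r.val < 2 → c.val < 2 → l.val = 2 + 2 * r.val + c.val ∧ m.val = 2 + 2 * r.val + c.val) →
      (r.val < 2 → l.val < 2 → c.val = 2 + 2 * r.val + l.val) →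
      (c.val < 2 → l.val < 2 → r.val = 2 + 2 * c.val + l.val) →
      net64Unary r c l m = true := by decide +kernel
  apply net64_core1 (fun i p => (E i).symm (c i p))
  · intro i i' hi j j'
    simp only [Equiv.symm_apply_eq]
    exact hpt i i' hi _ _
  · intro p
    apply key
    · have := hsum p
      rw [hlt 0, hlt 1, hlt 2, hlt 3] at this
      exact this
    · intro h1 h2
      exact ⟨n2 p _ _ (hsp 0 p h1) (hsp 1 p h2), n3 p _ _ (hsp 0 p h1) (hsp 1 p h2)⟩
    · intro h1 h2
      exact n1 p _ _ (hsp 0 p h1) (hsp 2 p h2)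
    · intro h1 h2
      exact n0 p _ _ (hsp 1 p h1) (hsp 2 p h2)

theorem net64_sum_mul {P : Type} [Fintype P] (c : Fin 4 → P → Fin 6)
    (hpt : ∀ i i' : Fin 4, i ≠ i' → ∀ j j', ∃! p, c i p = j ∧ c i' p = j')
    (i i' : Fin 4) (hi : i ≠ i') (A B : Fin 6 → ℤ) :
    ∑ p, A (c i p) * B (c i' p) = (∑ j, A j) * ∑ j, B j := by
  have hb : Function.Bijective (fun p => (c i p, c i' p)) := by
    rw [Function.bijective_iff_existsUnique]
    rintro ⟨j, j'⟩
    simpa only [Prod.mk.injEq] using hpt i i' hi j j'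
  rw [Finset.sum_mul_sum, ← Fintype.sum_prod_type']
  exact hb.sum_comp (fun x : Fin 6 × Fin 6 => A x.1 * B x.2)

theorem net64_sum_one {P : Type} [Fintype P] (c : Fin 4 → P → Fin 6)
    (hpt : ∀ i i' : Fin 4, i ≠ i' → ∀ j j', ∃! p, c i p = j ∧ c i' p = j')
    (i : Fin 4) (A : Fin 6 → ℤ) :
    ∑ p, A (c i p) = 6 * ∑ j, A j := by
  obtain ⟨i', hi⟩ := exists_ne i
  have := net64_sum_mul c hpt i i' hi.symm A (fun _ => 1)
  simp only [mul_one, Finset.sum_const, Finset.card_univ, Fintype.card_fin] at this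
  rw [this]
  simp [mul_comm]

/-- The integer indicator of a Boolean. -/
def net64Ind (b : Bool) : ℤ := if b then 1 else 0

/-- No dependency with two lines in every class. -/
theorem net64_no_two {P : Type} [Fintype P] (c : Fin 4 → P → Fin 6)
    (hpt : ∀ i i' : Fin 4, i ≠ i' → ∀ j j', ∃! p, c i p = j ∧ c i' p = j')
    (g : Fin 4 → Fin 6 → Bool)
    (hpar : ∀ p, (g 0 (c 0 p) ^^ g 1 (c 1 p) ^^ g 2 (c 2 p) ^^ g 3 (c 3 p)) = false)
    (hw : ∀ i, ∑ j, net64Ind (g i j) = 2) : False := by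
  have hs : ∀ i, ∃ u v, u ≠ v ∧ ∀ w, g i w = true ↔ w = u ∨ w = v := by
    intro i
    have h := hw i
    unfold net64Ind at h
    rw [Finset.sum_boole] at h
    have h2 : (Finset.univ.filter fun j => g i j = true).card = 2 := by exact_mod_cast h
    obtain ⟨u, v, huv, he⟩ := Finset.card_eq_two.mp h2
    refine ⟨u, v, huv, fun w => ?_⟩
    have := congrArg (w ∈ ·) he
    simpa using this
  choose u v huv hg using hs
  let F : Fin 4 → P → ℤ := fun i p => net64Ind (g i (c i p))
  let H : P → ℤ := fun p => F 0 p + F 1 p + F 2 p + F 3 p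
  have hpp : ∀ i i', i ≠ i' → ∑ p, F i p * F i' p = 4 := by
    intro i i' hi
    have := net64_sum_mul c hpt i i' hi (fun j => net64Ind (g i j)) (fun j => net64Ind (g i' j))
    rw [hw, hw] at this
    exact this
  have hp1 : ∀ i, ∑ p, F i p = 12 := by
    intro i
    have := net64_sum_one c hpt i (fun j => net64Ind (g i j))
    rw [hw] at this
    exact this
  have hsq : ∀ i p, F i p * F i p = F i p := by
    intro i p
    simp only [F, net64Ind]
    split_ifs <;> rfl
  have htot : ∑ p, H p * (H p - 2) = 0 := by
    have e : ∀ p, H p * (H p - 2) = 2 * (F 0 p * F 1 p) + 2 * (F 0 p * F 2 p)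
        + 2 * (F 0 p * F 3 p) + 2 * (F 1 p * F 2 p) + 2 * (F 1 p * F 3 p) + 2 * (F 2 p * F 3 p)
        - (F 0 p + F 1 p + F 2 p + F 3 p) := by
      intro p
      have h0 := hsq 0 p
      have h1 := hsq 1 p
      have h2 := hsq 2 p
      have h3 := hsq 3 p
      simp only [H]
      linear_combination h0 + h1 + h2 + h3
    simp only [e, Finset.sum_sub_distrib, Finset.sum_add_distrib, ← Finset.mul_sum, hp1]
    rw [hpp 0 1 (by decide), hpp 0 2 (by decide), hpp 0 3 (by decide), hpp 1 2 (by decide),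
      hpp 1 3 (by decide), hpp 2 3 (by decide)]
    norm_num
  have hnn : ∀ p ∈ Finset.univ, 0 ≤ H p * (H p - 2) := by
    intro p _
    have := hpar p
    simp only [H, F, net64Ind]
    revert this
    generalize g 0 (c 0 p) = a0
    generalize g 1 (c 1 p) = a1
    generalize g 2 (c 2 p) = a2
    generalize g 3 (c 3 p) = a3
    revert a0 a1 a2 a3
    decide
  have hz := (Finset.sum_eq_zero_iff_of_nonneg hnn).mp htot
  apply net64_core2 c hpt g (fun i => ![u i, v i]) (fun i => huv i) (fun i w => hg i w)
  intro p
  have := hz p (Finset.mem_univ p)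
  simp only [H, F, net64Ind] at this
  revert this
  generalize g 0 (c 0 p) = a0
  generalize g 1 (c 1 p) = a1
  generalize g 2 (c 2 p) = a2
  generalize g 3 (c 3 p) = a3
  revert a0 a1 a2 a3
  decide

theorem net64_weights {P : Type} [Fintype P] (c : Fin 4 → P → Fin 6)
    (hpt : ∀ i i' : Fin 4, i ≠ i' → ∀ j j', ∃! p, c i p = j ∧ c i' p = j')
    (f : Fin 4 → Fin 6 → Bool)
    (hpar : ∀ p, (f 0 (c 0 p) ^^ f 1 (c 1 p) ^^ f 2 (c 2 p) ^^ f 3 (c 3 p)) = false) :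
    ∀ i, (∀ j, f i j = true) ∨ (∀ j, f i j = false) := by
  let l : Fin 4 → ℤ := fun i => ∑ j, net64Ind (f i j)
  let F : Fin 4 → P → ℤ := fun i p => net64Ind (f i (c i p))
  have hl : ∀ i, l i = (Finset.univ.filter fun j => f i j = true).card := by
    intro i
    simp only [l, net64Ind]
    rw [Finset.sum_boole]
  have hle : ∀ i, (Finset.univ.filter fun j => f i j = true).card < 7 := by
    intro i
    have := Finset.card_le_univ (Finset.univ.filter fun j => f i j = true)
    rw [Fintype.card_fin] at this
    omega
  have hG : ∀ i, ∑ j, (1 - 2 * net64Ind (f i j)) = 6 - 2 * l i := by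
    intro i
    simp [l, Finset.sum_sub_distrib, Finset.mul_sum]
  have hprod : ∀ i i', i ≠ i' →
      ∑ p, (1 - 2 * F i p) * (1 - 2 * F i' p) = (6 - 2 * l i) * (6 - 2 * l i') := by
    intro i i' hi
    rw [← hG, ← hG]
    exact net64_sum_mul c hpt i i' hi (fun j => 1 - 2 * net64Ind (f i j))
      (fun j => 1 - 2 * net64Ind (f i' j))
  have hpt2 : ∀ p, (1 - 2 * F 0 p) * (1 - 2 * F 1 p) = (1 - 2 * F 2 p) * (1 - 2 * F 3 p) ∧
      (1 - 2 * F 0 p) * (1 - 2 * F 2 p) = (1 - 2 * F 1 p) * (1 - 2 * F 3 p) ∧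
      (1 - 2 * F 0 p) * (1 - 2 * F 3 p) = (1 - 2 * F 1 p) * (1 - 2 * F 2 p) ∧
      2 ∣ F 0 p + F 1 p + F 2 p + F 3 p := by
    intro p
    have := hpar p
    simp only [F, net64Ind]
    revert this
    generalize f 0 (c 0 p) = a0
    generalize f 1 (c 1 p) = a1
    generalize f 2 (c 2 p) = a2
    generalize f 3 (c 3 p) = a3
    revert a0 a1 a2 a3
    decide
  have e1 : (6 - 2 * l 0) * (6 - 2 * l 1) = (6 - 2 * l 2) * (6 - 2 * l 3) := by
    rw [← hprod 0 1 (by decide), ← hprod 2 3 (by decide)]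
    exact Finset.sum_congr rfl fun p _ => (hpt2 p).1
  have e2 : (6 - 2 * l 0) * (6 - 2 * l 2) = (6 - 2 * l 1) * (6 - 2 * l 3) := by
    rw [← hprod 0 2 (by decide), ← hprod 1 3 (by decide)]
    exact Finset.sum_congr rfl fun p _ => (hpt2 p).2.1
  have e3 : (6 - 2 * l 0) * (6 - 2 * l 3) = (6 - 2 * l 1) * (6 - 2 * l 2) := by
    rw [← hprod 0 3 (by decide), ← hprod 1 2 (by decide)]
    exact Finset.sum_congr rfl fun p _ => (hpt2 p).2.2.1
  have hpar3 : ∀ i j k m : Fin 4, i ≠ j → i ≠ k → i ≠ m →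
      (∀ p, 2 ∣ F i p + F j p + F k p + F m p) → 2 ∣ l j + l k + l m := by
    intro i j k m hij hik him h
    let D : Fin 6 → ℤ := fun t => if t = 0 then 1 else 0
    have hD : ∑ t, D t = 1 := by simp [D]
    have hq : ∀ j, i ≠ j → ∑ p, D (c i p) * F j p = l j := by
      intro j hij
      have := net64_sum_mul c hpt i j hij D (fun t => net64Ind (f j t))
      rw [hD, one_mul] at this
      exact this
    have hqi : ∑ p, D (c i p) * F i p = 6 * ∑ t, D t * net64Ind (f i t) :=
      net64_sum_one c hpt i (fun t => D t * net64Ind (f i t))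
    have hdvd : 2 ∣ ∑ p, D (c i p) * (F i p + F j p + F k p + F m p) :=
      Finset.dvd_sum fun p _ => Dvd.dvd.mul_left (h p) _
    simp only [mul_add, Finset.sum_add_distrib] at hdvd
    rw [hqi, hq j hij, hq k hik, hq m him] at hdvd
    omega
  have d0 := hpar3 0 1 2 3 (by decide) (by decide) (by decide) (fun p => (hpt2 p).2.2.2)
  have d1 := hpar3 1 0 2 3 (by decide) (by decide) (by decide)
    (fun p => by have := (hpt2 p).2.2.2; omega)
  have d2 := hpar3 2 0 1 3 (by decide) (by decide) (by decide)
    (fun p => by have := (hpt2 p).2.2.2; omega)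
  have d3 := hpar3 3 0 1 2 (by decide) (by decide) (by decide)
    (fun p => by have := (hpt2 p).2.2.2; omega)
  have key : ∀ a b c d : Fin 7,
      (6 - 2 * (a.val : ℤ)) * (6 - 2 * (b.val : ℤ)) = (6 - 2 * (c.val : ℤ)) * (6 - 2 * (d.val : ℤ)) →
      (6 - 2 * (a.val : ℤ)) * (6 - 2 * (c.val : ℤ)) = (6 - 2 * (b.val : ℤ)) * (6 - 2 * (d.val : ℤ)) →
      (6 - 2 * (a.val : ℤ)) * (6 - 2 * (d.val : ℤ)) = (6 - 2 * (b.val : ℤ)) * (6 - 2 * (c.val : ℤ)) →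
      (2 : ℤ) ∣ b.val + c.val + d.val → (2 : ℤ) ∣ a.val + c.val + d.val →
      (2 : ℤ) ∣ a.val + b.val + d.val → (2 : ℤ) ∣ a.val + b.val + c.val →
      ((a.val = 0 ∨ a.val = 6) ∧ (b.val = 0 ∨ b.val = 6) ∧ (c.val = 0 ∨ c.val = 6) ∧
        (d.val = 0 ∨ d.val = 6)) ∨
      ((a.val = 2 ∨ a.val = 4) ∧ (b.val = 2 ∨ b.val = 4) ∧ (c.val = 2 ∨ c.val = 4) ∧
        (d.val = 2 ∨ d.val = 4) ∧
        (decide (a.val = 4) ^^ decide (b.val = 4) ^^ decide (c.val = 4) ^^ decide (d.val = 4))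
          = false) := by decide +kernel
  let n : Fin 4 → ℕ := fun i => (Finset.univ.filter fun j => f i j = true).card
  have hln : ∀ i, l i = (n i : ℤ) := hl
  have hn7 : ∀ i, n i < 7 := hle
  rw [hln 0, hln 1, hln 2, hln 3] at e1 e2 e3
  simp only [hln] at d0 d1 d2 d3
  rcases key ⟨n 0, hn7 0⟩ ⟨n 1, hn7 1⟩ ⟨n 2, hn7 2⟩ ⟨n 3, hn7 3⟩ e1 e2 e3 d0 d1 d2 d3 with h | h
  · have h06 : ∀ i, n i = 0 ∨ n i = 6 := by
      obtain ⟨h0, h1, h2, h3⟩ := h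
      intro i
      fin_cases i
      exacts [h0, h1, h2, h3]
    intro i
    rcases h06 i with h | h
    · right
      intro j
      have := Finset.card_eq_zero.mp h
      rw [Finset.filter_eq_empty_iff] at this
      simpa using this (Finset.mem_univ j)
    · left
      intro j
      have h' : (Finset.univ.filter fun j => f i j = true) = Finset.univ := by
        rw [← Finset.card_eq_iff_eq_univ, Fintype.card_fin]
        exact h
      have : j ∈ (Finset.univ.filter fun j => f i j = true) := by rw [h']; simp
      simpa using this
  · exfalso
    obtain ⟨h0, h1, h2, h3, hx⟩ := h
    have h24 : ∀ i, n i = 2 ∨ n i = 4 := by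
      intro i
      fin_cases i
      exacts [h0, h1, h2, h3]
    apply net64_no_two c hpt (fun i j => f i j ^^ decide (n i = 4))
    · intro p
      have hp := hpar p
      simp only at hx
      revert hp hx
      generalize f 0 (c 0 p) = a0
      generalize f 1 (c 1 p) = a1
      generalize f 2 (c 2 p) = a2
      generalize f 3 (c 3 p) = a3
      generalize decide (n 0 = 4) = b0
      generalize decide (n 1 = 4) = b1
      generalize decide (n 2 = 4) = b2
      generalize decide (n 3 = 4) = b3
      revert a0 a1 a2 a3 b0 b1 b2 b3
      decide
    · intro i
      have hli : ∑ j, net64Ind (f i j) = (n i : ℤ) := hl i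
      rcases h24 i with h | h
      · simp only [h]
        rw [h] at hli
        simpa using hli
      · have hneg : ∀ j, net64Ind (f i j ^^ decide (n i = 4)) = 1 - net64Ind (f i j) := by
          intro j
          rw [h]
          cases f i j <;> rfl
        rw [Finset.sum_congr rfl fun j _ => hneg j, Finset.sum_sub_distrib, hli, h]
        simp

theorem net64_dep {P : Type} [Fintype P] [DecidableEq P] (N : Net64 P)
    (Λ : Finset (Fin 4 × Fin 6)) (hΛ : N.cSum Λ = 0) :
    ∃ S : Finset (Fin 4), Even S.card ∧ Λ = S ×ˢ (Finset.univ : Finset (Fin 6)) := by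
  choose c hc hcu using fun i p => N.partition i p
  have hmem : ∀ i p j, p ∈ N.line i j ↔ c i p = j := by
    intro i p j
    constructor
    · intro h; exact (hcu i p j h).symm
    · rintro rfl; exact hc i p
  have hpt : ∀ i i' : Fin 4, i ≠ i' → ∀ j j', ∃! p, c i p = j ∧ c i' p = j' := by
    intro i i' hi j j'
    obtain ⟨p, hp⟩ := Finset.card_eq_one.mp (N.meet i i' j j' hi)
    have h : ∀ q, (c i q = j ∧ c i' q = j') ↔ q = p := by
      intro q
      rw [← hmem, ← hmem, ← Finset.mem_inter, hp, Finset.mem_singleton]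
    exact ⟨p, (h p).mpr rfl, fun q hq => (h q).mp hq⟩
  let f : Fin 4 → Fin 6 → Bool := fun i j => decide ((i, j) ∈ Λ)
  have hz : ∀ p, ∑ i, (if f i (c i p) = true then (1 : ZMod 2) else 0) = 0 := by
    intro p
    have h := congrFun hΛ p
    rw [Net64.cSum, Finset.sum_apply] at h
    have e : ∑ x ∈ Λ, chi (N.line x.1 x.2) p =
        ∑ x : Fin 4 × Fin 6, if x ∈ Λ then chi (N.line x.1 x.2) p else 0 := by
      rw [Finset.sum_ite_mem, Finset.univ_inter]
    rw [e, Fintype.sum_prod_type] at h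
    rw [Pi.zero_apply] at h
    refine Eq.trans ?_ h
    refine Finset.sum_congr rfl fun i _ => ?_
    rw [Finset.sum_eq_single (c i p)]
    · have : p ∈ N.line i (c i p) := hc i p
      simp [chi, f, this]
    · intro j _ hj
      simp [chi, hmem, hj.symm]
    · simp
  have hpar : ∀ p, (f 0 (c 0 p) ^^ f 1 (c 1 p) ^^ f 2 (c 2 p) ^^ f 3 (c 3 p)) = false := by
    intro p
    have h := hz p
    rw [Fin.sum_univ_four] at h
    revert h
    generalize f 0 (c 0 p) = a0
    generalize f 1 (c 1 p) = a1
    generalize f 2 (c 2 p) = a2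
    generalize f 3 (c 3 p) = a3
    revert a0 a1 a2 a3
    decide
  have hw := net64_weights c hpt f hpar
  have hconst : ∀ i j j', f i j = f i j' := by
    intro i j j'
    rcases hw i with h | h <;> rw [h, h]
  refine ⟨Finset.univ.filter fun i => f i 0 = true, ?_, ?_⟩
  · obtain ⟨p, -⟩ := (hpt 0 1 (by decide) 0 0).exists
    have h := hz p
    simp only [hconst _ (c _ p) 0] at h
    rw [Finset.sum_boole, ZMod.natCast_eq_zero_iff] at h
    exact even_iff_two_dvd.mpr h
  · ext ⟨i, j⟩
    simp only [Finset.mem_product, Finset.mem_filter, Finset.mem_univ, true_and, and_true]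
    rw [hconst i 0 j]
    simp [f]

theorem net64_rank {P : Type} [Fintype P] [DecidableEq P] (N : Net64 P) :
    21 ≤ Module.finrank (ZMod 2) N.code := by
  let v : Fin 4 × Fin 6 → P → ZMod 2 := fun x => chi (N.line x.1 x.2)
  let T : (Fin 4 × Fin 6 → ZMod 2) →ₗ[ZMod 2] (P → ZMod 2) :=
    Fintype.linearCombination (ZMod 2) v
  have hr : LinearMap.range T = N.code := Fintype.range_linearCombination (ZMod 2) v
  have hrn := LinearMap.finrank_range_add_finrank_ker T
  rw [hr, Module.finrank_fintype_fun_eq_card] at hrn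
  have hcard : Fintype.card (Fin 4 × Fin 6) = 24 := by simp
  let R : (Fin 4 × Fin 6 → ZMod 2) →ₗ[ZMod 2] (Fin 3 → ZMod 2) :=
    LinearMap.funLeft (ZMod 2) (ZMod 2) (fun i : Fin 3 => (i.castSucc, (0 : Fin 6)))
  have hinj : Function.Injective (R ∘ₗ (LinearMap.ker T).subtype) := by
    rw [← LinearMap.ker_eq_bot, LinearMap.ker_eq_bot']
    rintro ⟨x, hx⟩ hR
    have h01 : ∀ y : ZMod 2, y = if y ≠ 0 then 1 else 0 := by decide
    have hsum : N.cSum (Finset.univ.filter fun t => x t ≠ 0) = 0 := by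
      rw [LinearMap.mem_ker] at hx
      rw [← hx, Net64.cSum, Finset.sum_filter]
      show _ = ∑ t, x t • v t
      refine Finset.sum_congr rfl fun t _ => ?_
      rw [h01 (x t)]
      by_cases h : x t = 0 <;> simp [h, v]
    obtain ⟨S, hS, hE⟩ := net64_dep N _ hsum
    have hm : ∀ i j, x (i, j) ≠ 0 ↔ i ∈ S := by
      intro i j
      have := congrArg ((i, j) ∈ ·) hE
      simpa using this
    have hn : ∀ i : Fin 3, i.castSucc ∉ S := by
      intro i hi
      exact (hm _ 0).mpr hi (congrFun hR i)
    have hS0 : S = ∅ := by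
      have a0 := hn 0
      have a1 := hn 1
      have a2 := hn 2
      exact (by decide : ∀ S : Finset (Fin 4), Even S.card → Fin.castSucc (0 : Fin 3) ∉ S →
        Fin.castSucc (1 : Fin 3) ∉ S → Fin.castSucc (2 : Fin 3) ∉ S → S = ∅) S hS a0 a1 a2
    apply Subtype.ext
    funext ⟨i, j⟩
    have := hm i j
    rw [hS0] at this
    simpa using this
  have hk := LinearMap.finrank_le_finrank_of_injective hinj
  rw [Module.finrank_fintype_fun_eq_card, Fintype.card_fin] at hk
  omega

/-- The binary code of a `(6,4)` net has dimension at least 21: the only `F₂`-linear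
dependencies among the 24 characteristic functions of the lines are those generated by
the parallel class dependencies, i.e. every set of lines with vanishing `F₂`-sum is a
union of an even number of full parallel classes; hence `dim C ≥ 24 − 3 = 21`. -/
theorem net64_code_finrank_ge_21 {P : Type} [Fintype P] [DecidableEq P] (N : Net64 P) :
    (∀ Λ : Finset (Fin 4 × Fin 6), N.cSum Λ = 0 →
      ∃ S : Finset (Fin 4), Even S.card ∧ Λ = S ×ˢ (Finset.univ : Finset (Fin 6))) ∧
    21 ≤ Module.finrank (ZMod 2) N.code := by
  exact ⟨net64_dep N, net64_rank N⟩
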